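/- arXiv:1910.08672 — 4 statements merged into one kernel-verified Lean document; each statement's English description precedes it below -/
import Mathlib

section
/- Let x ≥ 0 and δ ≥ 0, let X : [0,∞) → ℝ be a càdlàg function with X(0) = 0, and let Z : [0,∞) → [0,∞) be a càdlàg function satisfying Z(t) = x + X(C(t)) + δ·t for all t ≥ 0, where C(t) = ∫₀ᵗ Z(s) ds. Assume C is strictly increasing and C(t) → ∞ as t → ∞, and set V(r) = inf{t ≥ 0 : C(t) > r}. Then for every t ≥ 0, ∫₀^{V(t)} (Z(u) − δ·u)·Z(u) du = x·t + ∫₀ᵗ X(u) du. -/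
open MeasureTheory Filter Set

/-- A real-valued function on `[0,∞)` is càdlàg: right-continuous at every `t ≥ 0`
and with finite left limits at every `t > 0`. -/
def IsCadlag (f : ℝ → ℝ) : Prop :=
  (∀ t : ℝ, 0 ≤ t → ContinuousWithinAt f (Set.Ici t) t) ∧
  (∀ t : ℝ, 0 < t → ∃ l : ℝ, Filter.Tendsto f (nhdsWithin t (Set.Iio t)) (nhds l))

open Topology in
def GCad (f : ℝ → ℝ) : Prop :=
  ∀ t : ℝ, ContinuousWithinAt f (Set.Ici t) t ∧ ∃ l : ℝ, Tendsto f (𝓝[<] t) (𝓝 l)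

lemma GCad.meas {f : ℝ → ℝ} (h : GCad f) : Measurable f := by
  have key : ∀ n : ℕ, Measurable (fun r : ℝ => f (((⌊((n:ℝ)+1) * r⌋ : ℝ) + 1) / ((n:ℝ)+1))) := by
    intro n
    have h1 : Measurable (fun k : ℤ => f (((k : ℝ) + 1) / ((n:ℝ)+1))) := measurable_from_top
    exact h1.comp (Int.measurable_floor.comp (measurable_const.mul measurable_id))
  refine measurable_of_tendsto_metrizable key ?_
  rw [tendsto_pi_nhds]
  intro r
  have hc : Tendsto f (nhdsWithin r (Set.Ici r)) (nhds (f r)) := (h r).1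
  refine hc.comp ?_
  have hb : ∀ n : ℕ, r ≤ ((⌊((n:ℝ)+1) * r⌋ : ℝ) + 1) / ((n:ℝ)+1) := by
    intro n
    have : (0:ℝ) < (n:ℝ)+1 := by positivity
    rw [le_div_iff₀ this]
    nlinarith [Int.lt_floor_add_one (((n:ℝ)+1) * r)]
  refine tendsto_nhdsWithin_iff.2 ⟨?_, Eventually.of_forall hb⟩
  have hu : ∀ n : ℕ, ((⌊((n:ℝ)+1) * r⌋ : ℝ) + 1) / ((n:ℝ)+1) ≤ r + 1 / ((n:ℝ)+1) := by
    intro n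
    have : (0:ℝ) < (n:ℝ)+1 := by positivity
    rw [div_le_iff₀ this, add_mul r, one_div, inv_mul_cancel₀ this.ne']
    nlinarith [Int.floor_le (((n:ℝ)+1) * r)]
  refine tendsto_of_tendsto_of_tendsto_of_le_of_le tendsto_const_nhds ?_ hb hu
  simpa using (tendsto_const_nhds (x := r)).add (tendsto_one_div_add_atTop_nhds_zero_nat (𝕜 := ℝ))

lemma GCad.ii {f : ℝ → ℝ} (h : GCad f) (a b : ℝ) : IntervalIntegrable f volume a b := by
  have hl : LocallyIntegrable f volume := by
    intro t
    rw [← nhdsLT_sup_nhdsGE]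
    obtain ⟨l, hl⟩ := (h t).2
    refine IntegrableAtFilter.sup_iff.2 ⟨?_, ?_⟩
    · exact (volume.finiteAt_nhdsWithin t _).integrableAtFilter_of_tendsto
        (h.meas.stronglyMeasurable.stronglyMeasurableAtFilter) hl
    · exact (volume.finiteAt_nhdsWithin t _).integrableAtFilter_of_tendsto
        (h.meas.stronglyMeasurable.stronglyMeasurableAtFilter) (h t).1
  exact (hl.integrableOn_isCompact isCompact_uIcc).intervalIntegrable

lemma GCad.cont {f : ℝ → ℝ} (h : GCad f) : Continuous (fun t => ∫ s in (0:ℝ)..t, f s) :=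
  intervalIntegral.continuous_primitive h.ii 0

lemma GCad.deriv {f : ℝ → ℝ} (h : GCad f) (t : ℝ) :
    HasDerivWithinAt (fun t => ∫ s in (0:ℝ)..t, f s) (f t) (Set.Ici t) t :=
  intervalIntegral.integral_hasDerivWithinAt_right (h.ii 0 t)
    (h.meas.stronglyMeasurable.stronglyMeasurableAtFilter)
    ((h t).1.mono Set.Ioi_subset_Ici_self)

lemma IsCadlag.ext {f : ℝ → ℝ} (h : IsCadlag f) : GCad (fun t => f (max 0 t)) := by
  intro t
  constructor
  · have h1 : ContinuousWithinAt f (Set.Ici (max 0 t)) (max 0 t) := h.1 _ (le_max_left _ _)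
    refine ContinuousWithinAt.comp (t := Set.Ici (max 0 t)) (f := fun t : ℝ => max 0 t) h1
      (by fun_prop) ?_
    intro s hs
    exact max_le_max le_rfl (Set.mem_Ici.1 hs)
  · rcases le_or_gt t 0 with ht | ht
    · refine ⟨f 0, tendsto_const_nhds.congr' ?_⟩
      filter_upwards [self_mem_nhdsWithin] with s hs
      rw [max_eq_left (le_trans (le_of_lt hs) ht)]
    · obtain ⟨l, hl⟩ := h.2 t ht
      refine ⟨l, hl.congr' ?_⟩
      filter_upwards [nhdsWithin_le_nhds (lt_mem_nhds ht)] with s hs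
      rw [max_eq_right (le_of_lt hs)]

lemma GCad.prod {f : ℝ → ℝ} (h : GCad f) (δ : ℝ) : GCad (fun u => (f u - δ * u) * f u) := by
  intro t
  refine ⟨((h t).1.sub (by fun_prop)).mul (h t).1, ?_⟩
  obtain ⟨l, hl⟩ := (h t).2
  have : Tendsto (fun u : ℝ => δ * u) (nhdsWithin t (Set.Iio t)) (nhds (δ * t)) :=
    (Continuous.tendsto (by fun_prop) t).mono_left nhdsWithin_le_nhds
  exact ⟨_, (hl.sub this).mul hl⟩

/-- **Lamperti-transform integral identity (Lemma 1, pathwise form).**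
Let `x ≥ 0`, `δ ≥ 0`, let `X` be càdlàg with `X 0 = 0`, and let `Z ≥ 0` be càdlàg
satisfying `Z t = x + X (C t) + δ·t` for all `t ≥ 0`, where `C t = ∫₀ᵗ Z`. Assume `C`
is strictly increasing on `[0,∞)` and `C t → ∞`, and set `V r = inf {t ≥ 0 : C t > r}`.
Then for every `t ≥ 0`, `∫₀^{V t} (Z u − δ·u)·Z u du = x·t + ∫₀ᵗ X u du`. -/
theorem lamperti_integral_identity
    (x δ : ℝ) (hx : 0 ≤ x) (hδ : 0 ≤ δ)
    (X Z C V : ℝ → ℝ)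
    (hXcadlag : IsCadlag X) (hX0 : X 0 = 0)
    (hZcadlag : IsCadlag Z) (hZnonneg : ∀ t : ℝ, 0 ≤ t → 0 ≤ Z t)
    (hC : ∀ t : ℝ, C t = ∫ s in (0:ℝ)..t, Z s)
    (hLamperti : ∀ t : ℝ, 0 ≤ t → Z t = x + X (C t) + δ * t)
    (hCmono : StrictMonoOn C (Set.Ici 0))
    (hCtop : Filter.Tendsto C Filter.atTop Filter.atTop)
    (hV : ∀ r : ℝ, V r = sInf {t : ℝ | 0 ≤ t ∧ C t > r}) :
    ∀ t : ℝ, 0 ≤ t →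
      ∫ u in (0:ℝ)..(V t), (Z u - δ * u) * Z u = x * t + ∫ u in (0:ℝ)..t, X u := by
  intro t ht
  have hXe := hXcadlag.ext
  have hZe := hZcadlag.ext
  have hPe := hZe.prod δ
  have hC' : ∀ s, 0 ≤ s → C s = ∫ u in (0:ℝ)..s, Z (max 0 u) := by
    intro s hs
    rw [hC]
    refine intervalIntegral.integral_congr fun u hu => ?_
    rw [Set.uIcc_of_le hs] at hu
    simp only [max_eq_right hu.1]
  have hC0 : C 0 = 0 := by simp [hC]
  have hCc : ContinuousOn C (Set.Ici 0) :=
    hZe.cont.continuousOn.congr fun s hs => hC' s hs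
  have hCd : ∀ s, 0 ≤ s → HasDerivWithinAt C (Z s) (Set.Ici s) s := by
    intro s hs
    have := hZe.deriv s
    simp only [max_eq_right hs] at this
    exact this.congr (fun u hu => hC' u (le_trans hs hu)) (hC' s hs)
  have hCn : ∀ s, 0 ≤ s → 0 ≤ C s := fun s hs => by
    rw [← hC0]; exact hCmono.monotoneOn Set.self_mem_Ici hs hs
  -- find the inverse
  obtain ⟨T, hT0, hT⟩ : ∃ T, 0 ≤ T ∧ C T = t := by
    obtain ⟨b, hb0, hb⟩ := ((eventually_ge_atTop (0:ℝ)).and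
      (hCtop.eventually_ge_atTop t)).exists
    obtain ⟨T, hT, h⟩ := intermediate_value_Icc hb0 (hCc.mono Set.Icc_subset_Ici_self)
      (show t ∈ Set.Icc (C 0) (C b) from ⟨by rw [hC0]; exact ht, hb⟩)
    exact ⟨T, hT.1, h⟩
  have hVT : V t = T := by
    have : {s : ℝ | 0 ≤ s ∧ C s > t} = Set.Ioi T := by
      ext s
      constructor
      · rintro ⟨h0, h⟩
        rw [← hT] at h
        exact (hCmono.lt_iff_lt hT0 h0).1 h
      · intro h
        have h0 : 0 ≤ s := hT0.trans (le_of_lt h)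
        refine ⟨h0, ?_⟩
        rw [← hT]
        exact hCmono hT0 h0 h
    rw [hV, this, csInf_Ioi]
  have main := constant_of_has_deriv_right_zero (a := 0) (b := T)
    (f := fun s => (∫ u in (0:ℝ)..s, (Z (max 0 u) - δ * u) * Z (max 0 u))
      - x * C s - ∫ u in (0:ℝ)..(C s), X (max 0 u))
    (((hPe.cont.continuousOn).sub (continuousOn_const.mul (hCc.mono Set.Icc_subset_Ici_self))).sub
      (hXe.cont.comp_continuousOn (hCc.mono Set.Icc_subset_Ici_self)))
    (by
      intro s hs
      have hs0 : 0 ≤ s := hs.1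
      have d1 := hPe.deriv s
      have d2 := (hCd s hs0).const_mul x
      have d3 := HasDerivWithinAt.comp s (hXe.deriv (C s)) (hCd s hs0)
        (fun u hu => hCmono.monotoneOn hs0 (hs0.trans hu) hu)
      have d := (d1.sub d2).sub d3
      simp only [max_eq_right hs0, max_eq_right (hCn s hs0)] at d
      refine d.congr_deriv ?_
      linear_combination (Z s) * hLamperti s hs0) T ⟨hT0, le_rfl⟩
  simp only [hT, hC0, intervalIntegral.integral_same] at main
  have e1 : ∫ u in (0:ℝ)..T, (Z u - δ * u) * Z u
      = ∫ u in (0:ℝ)..T, (Z (max 0 u) - δ * u) * Z (max 0 u) := by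
    refine intervalIntegral.integral_congr fun u hu => ?_
    rw [Set.uIcc_of_le hT0] at hu
    simp only [max_eq_right hu.1]
  have e2 : ∫ u in (0:ℝ)..t, X u = ∫ u in (0:ℝ)..t, X (max 0 u) := by
    refine intervalIntegral.integral_congr fun u hu => ?_
    rw [Set.uIcc_of_le ht] at hu
    simp only [max_eq_right hu.1]
  rw [hVT, e1, e2]
  linarith
end

section
/- Let x ≥ 0 and δ ≥ 0, let X : [0,∞) → ℝ be a càdlàg function with X(0) = 0, and let Z : [0,∞) → [0,∞) be a càdlàg function satisfying Z(t) = x + X(C(t)) + δ·t for all t ≥ 0, where C(t) = ∫₀ᵗ Z(s) ds. Assume C is strictly increasing and C(t) → ∞ as t → ∞, and set V(r) = inf{t ≥ 0 : C(t) > r}. Then for every natural number n ≥ 1 and every r ≥ 0, ∫₀^{V(r)} (Z(u) − δ·u)ⁿ·Z(u) du = ∫₀ʳ (x + X(u))ⁿ du. -/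
open MeasureTheory Filter Set

open Topology

lemma IsCadlag.ext_right {f : ℝ → ℝ} (hf : IsCadlag f) (t : ℝ) :
    ContinuousWithinAt (fun u => f (max u 0)) (Set.Ici t) t := by
  have h := hf.1 (max t 0) (le_max_right _ _)
  refine ContinuousWithinAt.comp (t := Set.Ici (max t 0)) (f := fun u : ℝ => max u 0) h
    (by fun_prop) ?_
  intro u hu
  exact max_le_max_right 0 (Set.mem_Ici.1 hu)

lemma IsCadlag.ext_left {f : ℝ → ℝ} (hf : IsCadlag f) (t : ℝ) :
    ∃ l : ℝ, Tendsto (fun u => f (max u 0)) (𝓝[<] t) (𝓝 l) := by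
  rcases le_or_gt t 0 with ht | ht
  · refine ⟨f 0, tendsto_const_nhds.congr' ?_⟩
    filter_upwards [self_mem_nhdsWithin] with u hu
    rw [max_eq_right (le_trans (le_of_lt hu) ht)]
  · obtain ⟨l, hl⟩ := hf.2 t ht
    refine ⟨l, hl.congr' ?_⟩
    filter_upwards [mem_nhdsWithin_of_mem_nhds (Ioi_mem_nhds ht)] with u hu
    rw [max_eq_left (le_of_lt hu)]

lemma measurable_of_right_cont {g : ℝ → ℝ}
    (hg : ∀ t, ContinuousWithinAt g (Set.Ici t) t) : Measurable g := by
  have hm : ∀ n : ℕ, Measurable (fun t : ℝ => g (((⌊((n:ℝ)+1) * t⌋ : ℝ) + 1) / ((n:ℝ)+1))) := by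
    intro n
    have h1 : Measurable (fun k : ℤ => g (((k : ℝ) + 1) / ((n:ℝ)+1))) := measurable_from_top
    have h2 : Measurable (fun t : ℝ => ⌊((n:ℝ)+1) * t⌋) := by
      exact Int.measurable_floor.comp (measurable_const_mul _)
    exact h1.comp h2
  refine measurable_of_tendsto_metrizable hm ?_
  rw [tendsto_pi_nhds]
  intro t
  refine (hg t).tendsto.comp ?_
  have hlow : ∀ n : ℕ, t ≤ ((⌊((n:ℝ)+1) * t⌋ : ℝ) + 1) / ((n:ℝ)+1) := by
    intro n
    have : (0:ℝ) < (n:ℝ)+1 := by positivity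
    rw [le_div_iff₀ this, mul_comm]
    exact (Int.lt_floor_add_one _).le
  have hup : ∀ n : ℕ, ((⌊((n:ℝ)+1) * t⌋ : ℝ) + 1) / ((n:ℝ)+1) ≤ t + 1 / ((n:ℝ)+1) := by
    intro n
    have : (0:ℝ) < (n:ℝ)+1 := by positivity
    have e : (t + 1 / ((n:ℝ)+1)) * ((n:ℝ)+1) = ((n:ℝ)+1) * t + 1 := by field_simp
    rw [div_le_iff₀ this, e]
    have := Int.floor_le (((n:ℝ)+1) * t)
    linarith
  refine tendsto_nhdsWithin_iff.2 ⟨?_, Eventually.of_forall hlow⟩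
  refine tendsto_of_tendsto_of_tendsto_of_le_of_le tendsto_const_nhds ?_ hlow hup
  simpa using (tendsto_const_nhds (x := t)).add (tendsto_one_div_add_atTop_nhds_zero_nat (𝕜 := ℝ))

lemma IsCadlag.measurable_ext {f : ℝ → ℝ} (hf : IsCadlag f) :
    Measurable (fun u => f (max u 0)) :=
  measurable_of_right_cont hf.ext_right

lemma IsCadlag.locallyIntegrable_ext {f : ℝ → ℝ} (hf : IsCadlag f) :
    LocallyIntegrable (fun u => f (max u 0)) volume := by
  intro t
  have hm : ∀ l : Filter ℝ, StronglyMeasurableAtFilter (fun u => f (max u 0)) l volume :=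
    fun l => hf.measurable_ext.aestronglyMeasurable.stronglyMeasurableAtFilter
  rw [← nhdsLT_sup_nhdsGE]
  refine IntegrableAtFilter.sup_iff.2 ⟨?_, ?_⟩
  · obtain ⟨l, hl⟩ := hf.ext_left t
    exact hl.integrableAtFilter (hm _) (volume.finiteAt_nhdsWithin _ _)
  · exact (hf.ext_right t).tendsto.integrableAtFilter (hm _) (volume.finiteAt_nhdsWithin _ _)

lemma IsCadlag.intervalIntegrable {f : ℝ → ℝ} (hf : IsCadlag f) {b : ℝ} (hb : 0 ≤ b) :
    IntervalIntegrable f volume 0 b := by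
  have h : IntervalIntegrable (fun u => f (max u 0)) volume 0 b :=
    hf.locallyIntegrable_ext.integrableOn_isCompact isCompact_uIcc |>.intervalIntegrable
  refine h.congr ?_
  intro u hu
  rw [uIoc_of_le hb] at hu
  simp only [max_eq_left hu.1.le]

lemma IsCadlag.hasDeriv {f : ℝ → ℝ} (hf : IsCadlag f) {b : ℝ} (hb : 0 ≤ b) :
    HasDerivWithinAt (fun u => ∫ s in (0:ℝ)..u, f s) (f b) (Set.Ici b) b := by
  refine intervalIntegral.integral_hasDerivWithinAt_right (hf.intervalIntegrable hb)
    (t := Set.Ioi b) ?_ ((hf.1 b hb).mono Ioi_subset_Ici_self)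
  refine ⟨Set.Ioi b, self_mem_nhdsWithin, ?_⟩
  refine hf.measurable_ext.aestronglyMeasurable.congr ?_
  filter_upwards [ae_restrict_mem measurableSet_Ioi] with u hu
  rw [max_eq_left (hb.trans (le_of_lt hu))]

lemma IsCadlag.mul {f g : ℝ → ℝ} (hf : IsCadlag f) (hg : IsCadlag g) :
    IsCadlag (fun u => f u * g u) := by
  refine ⟨fun t ht => (hf.1 t ht).mul (hg.1 t ht), fun t ht => ?_⟩
  obtain ⟨l, hl⟩ := hf.2 t ht
  obtain ⟨m, hm⟩ := hg.2 t ht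
  exact ⟨_, hl.mul hm⟩

lemma IsCadlag.add {f g : ℝ → ℝ} (hf : IsCadlag f) (hg : IsCadlag g) :
    IsCadlag (fun u => f u + g u) := by
  refine ⟨fun t ht => (hf.1 t ht).add (hg.1 t ht), fun t ht => ?_⟩
  obtain ⟨l, hl⟩ := hf.2 t ht
  obtain ⟨m, hm⟩ := hg.2 t ht
  exact ⟨_, hl.add hm⟩

lemma isCadlag_of_continuous {f : ℝ → ℝ} (hf : Continuous f) : IsCadlag f :=
  ⟨fun t _ => hf.continuousWithinAt, fun t _ => ⟨f t, hf.continuousWithinAt⟩⟩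

lemma IsCadlag.pow {f : ℝ → ℝ} (hf : IsCadlag f) (n : ℕ) : IsCadlag (fun u => f u ^ n) := by
  induction n with
  | zero => simpa using isCadlag_of_continuous (continuous_const (y := (1:ℝ)))
  | succ k ih => simpa only [pow_succ] using ih.mul hf

lemma IsCadlag.continuousOn_integral {f : ℝ → ℝ} (hf : IsCadlag f) {b : ℝ} (hb : 0 ≤ b) :
    ContinuousOn (fun u => ∫ s in (0:ℝ)..u, f s) (Set.Icc 0 b) := by
  have := intervalIntegral.continuousOn_primitive_interval
    (f := f) (μ := volume) (a := 0) (b := b) (by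
      rw [uIcc_of_le hb]
      exact (intervalIntegrable_iff_integrableOn_Icc_of_le hb).1 (hf.intervalIntegrable hb))
  rwa [uIcc_of_le hb] at this

/-- **Lamperti-transform integral identity for powers (Corollary to Lemma 1, pathwise form).**
Let `x ≥ 0`, `δ ≥ 0`, let `X` be càdlàg with `X 0 = 0`, and let `Z ≥ 0` be càdlàg
satisfying `Z t = x + X (C t) + δ·t` for all `t ≥ 0`, where `C t = ∫₀ᵗ Z`. Assume `C`
is strictly increasing on `[0,∞)` and `C t → ∞`, and set `V r = inf {t ≥ 0 : C t > r}`.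
Then for every `n ≥ 1` and every `r ≥ 0`,
`∫₀^{V r} (Z u − δ·u)ⁿ·Z u du = ∫₀ʳ (x + X u)ⁿ du`. -/
theorem lamperti_integral_identity_powers
    (x δ : ℝ) (hx : 0 ≤ x) (hδ : 0 ≤ δ)
    (X Z C V : ℝ → ℝ)
    (hXcadlag : IsCadlag X) (hX0 : X 0 = 0)
    (hZcadlag : IsCadlag Z) (hZnonneg : ∀ t : ℝ, 0 ≤ t → 0 ≤ Z t)
    (hC : ∀ t : ℝ, C t = ∫ s in (0:ℝ)..t, Z s)
    (hLamperti : ∀ t : ℝ, 0 ≤ t → Z t = x + X (C t) + δ * t)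
    (hCmono : StrictMonoOn C (Set.Ici 0))
    (hCtop : Filter.Tendsto C Filter.atTop Filter.atTop)
    (hV : ∀ r : ℝ, V r = sInf {t : ℝ | 0 ≤ t ∧ C t > r}) :
    ∀ (n : ℕ), 1 ≤ n → ∀ r : ℝ, 0 ≤ r →
      ∫ u in (0:ℝ)..(V r), (Z u - δ * u) ^ n * Z u
        = ∫ u in (0:ℝ)..r, (x + X u) ^ n := by
  intro n _ r hr
  have hCe : C = fun t => ∫ s in (0:ℝ)..t, Z s := funext hC
  have hC0 : C 0 = 0 := by rw [hC]; simp
  have hCcont : ∀ b, 0 ≤ b → ContinuousOn C (Set.Icc 0 b) := fun b hb => by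
    rw [hCe]; exact hZcadlag.continuousOn_integral hb
  obtain ⟨T, hT0, hTr⟩ : ∃ T, 0 ≤ T ∧ C T = r := by
    obtain ⟨b, hb, hb0⟩ := ((hCtop.eventually_ge_atTop r).and (eventually_ge_atTop 0)).exists
    obtain ⟨T, hT, h⟩ := intermediate_value_Icc hb0 (hCcont b hb0) ⟨hC0.le.trans hr, hb⟩
    exact ⟨T, hT.1, h⟩
  have hVT : V r = T := by
    rw [hV]
    have : {t : ℝ | 0 ≤ t ∧ C t > r} = Set.Ioi T := by
      ext t
      simp only [Set.mem_setOf_eq, Set.mem_Ioi]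
      constructor
      · rintro ⟨h0, h⟩
        rw [← hTr] at h
        exact (hCmono.lt_iff_lt hT0 h0).1 h
      · intro h
        refine ⟨hT0.trans h.le, ?_⟩
        rw [← hTr]
        exact hCmono hT0 (hT0.trans h.le) h
    rw [this, csInf_Ioi]
  have hg : IsCadlag (fun u => (x + X u) ^ n) :=
    ((isCadlag_of_continuous continuous_const).add hXcadlag).pow n
  have hh : IsCadlag (fun u => (Z u - δ * u) ^ n * Z u) := by
    have := ((hZcadlag.add (isCadlag_of_continuous (f := fun u => -(δ * u)) (by fun_prop))).pow
      n).mul hZcadlag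
    simpa only [← sub_eq_add_neg] using this
  have hmaps : MapsTo C (Set.Icc 0 T) (Set.Icc 0 r) := by
    intro t ht
    rw [← hTr, ← hC0]
    exact ⟨hCmono.monotoneOn self_mem_Ici ht.1 ht.1, hCmono.monotoneOn ht.1 hT0 ht.2⟩
  have key := intervalIntegral.integral_eq_sub_of_hasDeriv_right_of_le
    (f := fun t => ∫ s in (0:ℝ)..(C t), (x + X s) ^ n)
    (f' := fun u => (Z u - δ * u) ^ n * Z u) hT0
    ((hg.continuousOn_integral hr).comp (hCcont T hT0) hmaps) (fun t ht => by
      have ht0 : 0 ≤ t := ht.1.le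
      have hCt : 0 ≤ C t := (hmaps ⟨ht0, ht.2.le⟩).1
      have h1 := hg.hasDeriv hCt
      have h2 : HasDerivWithinAt C (Z t) (Set.Ioi t) t := by
        rw [hCe]; exact (hZcadlag.hasDeriv ht0).mono Ioi_subset_Ici_self
      have h3 := h1.comp t h2 (fun u hu => (hCmono ht0 (ht0.trans (le_of_lt hu)) hu).le)
      have e : Z t - δ * t = x + X (C t) := by rw [hLamperti t ht0]; ring
      rw [e]
      exact h3) (hh.intervalIntegrable hT0)
  rw [hVT, key, hTr, hC0]
  simp
end

section
/- Let z : ℕ → ℕ be a sequence, set c(h) = ∑_{ℓ=0}^{h} z(ℓ), assume c(h) → ∞ as h → ∞, and for r ∈ ℕ let V(r) = min{h ∈ ℕ : c(h) > r}. Define K(p) = ∑_{j=0}^{p−1} (z(V(j)) − 1). Then for every r ∈ ℕ, K(r) ≤ K(c(V(r))) and K(c(V(r))) − K(r) ≤ z(V(r))·(z(V(r)) − 1). -/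
/-- **One-generation error bound for the cumulative cousin process.**
Let `z : ℕ → ℕ`, set `c h = ∑_{ℓ=0}^{h} z ℓ`, assume `c h → ∞`, and let
`V r = min {h : c h > r}`. Define `K p = ∑_{j=0}^{p-1} (z (V j) − 1)`. Then for every `r`,
`K r ≤ K (c (V r))` and `K (c (V r)) − K r ≤ z (V r) · (z (V r) − 1)`. -/
theorem cousin_process_error_bound
    (z c V K : ℕ → ℕ)
    (hc : ∀ h : ℕ, c h = ∑ ℓ ∈ Finset.range (h + 1), z ℓ)
    (hctop : Filter.Tendsto c Filter.atTop Filter.atTop)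
    (hV : ∀ r : ℕ, V r = sInf {h : ℕ | c h > r})
    (hK : ∀ p : ℕ, K p = ∑ j ∈ Finset.range p, (z (V j) - 1)) :
    ∀ r : ℕ, K r ≤ K (c (V r)) ∧ K (c (V r)) - K r ≤ z (V r) * (z (V r) - 1) := by
  intro r
  have hmem : ∀ r, r < c (V r) := by
    intro r
    have hne : {h : ℕ | c h > r}.Nonempty := (hctop.eventually_gt_atTop r).exists
    have := Nat.sInf_mem hne
    rw [← hV r] at this
    exact this
  have hmin : ∀ r h, r < c h → V r ≤ h := by
    intro r h hh
    rw [hV r]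
    exact Nat.sInf_le hh
  have hr := hmem r
  have hcz : c (V r) ≤ r + z (V r) := by
    rw [hc, Finset.sum_range_succ]
    rcases hv : V r with _ | m
    · simp
    · have h1 : ¬ r < c m := fun h => by
        have := hmin r m h
        omega
      rw [hc] at h1
      omega
  have hconst : ∀ j ∈ Finset.Ico r (c (V r)), z (V j) - 1 = z (V r) - 1 := by
    intro j hj
    rw [Finset.mem_Ico] at hj
    have h1 := hmin j _ hj.2
    have h2 := hmin r (V j) (lt_of_le_of_lt hj.1 (hmem j))
    rw [le_antisymm h1 h2]
  have hsum : K (c (V r)) = K r + (c (V r) - r) * (z (V r) - 1) := by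
    rw [hK (c (V r)), hK r, ← Finset.sum_range_add_sum_Ico _ hr.le, Finset.sum_congr rfl hconst]
    simp
  refine ⟨by rw [hsum]; exact Nat.le_add_right _ _, ?_⟩
  rw [hsum, Nat.add_sub_cancel_left]
  exact Nat.mul_le_mul_right _ (by omega)
end

section
/- Fix t > 0. Let f : [0,t] → ℝ be càdlàg (right-continuous on [0,t) with left limits on (0,t]), let (f_n) be a sequence of Borel measurable functions [0,t] → ℝ, and let (τ_n) be a sequence of continuous, strictly increasing bijections of [0,t] onto itself such that sup_{s∈[0,t]} |τ_n(s) − s| → 0 and sup_{s∈[0,t]} |f(τ_n(s)) − f_n(s)| → 0 as n → ∞. Then ∫₀ᵗ |f_n(s) − f(s)| ds → 0 as n → ∞. -/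
open MeasureTheory Filter Set

lemma bdd_aux (t : ℝ) (f : ℝ → ℝ)
    (hf_right : ∀ s ∈ Set.Ico (0:ℝ) t, ContinuousWithinAt f (Set.Ici s) s)
    (hf_left : ∀ s ∈ Set.Ioc (0:ℝ) t,
      ∃ l : ℝ, Filter.Tendsto f (nhdsWithin s (Set.Iio s)) (nhds l)) :
    ∃ M, ∀ x ∈ Set.Icc (0:ℝ) t, |f x| ≤ M := by
  refine (isCompact_Icc (a := (0:ℝ)) (b := t)).induction_on
    (p := fun s => ∃ M, ∀ x ∈ s, |f x| ≤ M) ⟨0, by simp⟩ ?_ ?_ ?_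
  · rintro s u hsu ⟨M, hM⟩
    exact ⟨M, fun x hx => hM x (hsu hx)⟩
  · rintro s u ⟨M, hM⟩ ⟨N, hN⟩
    refine ⟨max M N, ?_⟩
    rintro x (hx | hx)
    · exact (hM x hx).trans (le_max_left _ _)
    · exact (hN x hx).trans (le_max_right _ _)
  · intro x hx
    have hL : ∃ M, ∀ᶠ y in nhdsWithin x (Set.Iio x), y ∈ Set.Icc 0 t → |f y| ≤ M := by
      rcases hx.1.eq_or_lt with h | h
      · refine ⟨0, ?_⟩
        filter_upwards [self_mem_nhdsWithin] with y hy hy2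
        have := hy2.1
        simp only [Set.mem_Iio] at hy
        linarith
      · obtain ⟨l, hl⟩ := hf_left x ⟨h, hx.2⟩
        refine ⟨|l| + 1, ?_⟩
        filter_upwards [hl.abs.eventually_lt_const (lt_add_one _)] with y hy _
        exact hy.le
    have hR : ∃ M, ∀ᶠ y in nhdsWithin x (Set.Ici x), y ∈ Set.Icc 0 t → |f y| ≤ M := by
      rcases hx.2.eq_or_lt with h | h
      · refine ⟨|f t|, ?_⟩
        filter_upwards [self_mem_nhdsWithin] with y hy hy2
        have : y = t := le_antisymm hy2.2 (h ▸ hy)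
        rw [this]
      · have hl : Tendsto f _ _ := hf_right x ⟨hx.1, h⟩
        refine ⟨|f x| + 1, ?_⟩
        filter_upwards [hl.abs.eventually_lt_const (lt_add_one _)] with y hy _
        exact hy.le
    obtain ⟨M, hM⟩ := hL
    obtain ⟨N, hN⟩ := hR
    refine ⟨{y | y ∈ Set.Icc 0 t ∧ |f y| ≤ max M N}, ?_, max M N, fun y hy => hy.2⟩
    have h : ∀ᶠ y in nhds x, y ∈ Set.Icc 0 t → |f y| ≤ max M N := by
      rw [← nhdsLT_sup_nhdsGE, eventually_sup]
      exact ⟨hM.mono fun y h1 h2 => (h1 h2).trans (le_max_left _ _),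
        hN.mono fun y h1 h2 => (h1 h2).trans (le_max_right _ _)⟩
    filter_upwards [self_mem_nhdsWithin, mem_nhdsWithin_of_mem_nhds h] with y h1 h2
    exact ⟨h1, h2 h1⟩

lemma countable_aux (t : ℝ) (f : ℝ → ℝ)
    (hf_right : ∀ s ∈ Set.Ico (0:ℝ) t, ContinuousWithinAt f (Set.Ici s) s) :
    {x | x ∈ Set.Ioo 0 t ∧ ¬ ContinuousAt f x}.Countable := by
  let D : ℕ → Set ℝ := fun k => {x | x ∈ Set.Ioo 0 t ∧
    ¬ ∀ᶠ y in nhds x, |f y - f x| < 1 / ((k:ℝ) + 1)}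
  have hD : ∀ k, (D k).Countable := by
    intro k
    refine (countable_setOfPred_isolated_right_within (s := D k)).mono ?_
    intro x hx
    refine ⟨hx, ?_⟩
    have hk : (0:ℝ) < 1 / ((k:ℝ) + 1) / 2 := by positivity
    have h := Metric.tendsto_nhds.1 (hf_right x ⟨hx.1.1.le, hx.1.2⟩) _ hk
    obtain ⟨u, hu, hsub⟩ := (mem_nhdsGE_iff_exists_Ico_subset).1 h
    rw [← empty_mem_iff_bot]
    filter_upwards [self_mem_nhdsWithin, mem_nhdsWithin_of_mem_nhds (Iio_mem_nhds hu)]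
      with z hz0 hz1
    have hz : z ∈ D k := hz0.1
    have hzu : z ∈ Set.Ioo x u := ⟨hz0.2, hz1⟩
    exfalso
    apply hz.2
    filter_upwards [Ioo_mem_nhds hzu.1 hzu.2] with y hy
    have h1 := hsub ⟨hy.1.le, hy.2⟩
    have h2 := hsub ⟨hzu.1.le, hzu.2⟩
    simp only [Set.mem_ofPred_eq, Real.dist_eq] at h1 h2
    rw [abs_lt] at *
    constructor <;> linarith [h1.1, h1.2, h2.1, h2.2]
  refine (Set.countable_iUnion hD).mono ?_
  rintro x ⟨hx, hc⟩
  by_contra hcon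
  apply hc
  rw [ContinuousAt, Metric.tendsto_nhds]
  intro ε hε
  obtain ⟨k, hk⟩ := exists_nat_one_div_lt hε
  have : x ∉ D k := fun h => hcon (Set.mem_iUnion.2 ⟨k, h⟩)
  have h2 : ∀ᶠ y in nhds x, |f y - f x| < 1 / ((k:ℝ) + 1) := by
    by_contra h3
    exact this ⟨hx, h3⟩
  filter_upwards [h2] with y hy
  rw [Real.dist_eq]
  exact hy.trans hk

/-- **Skorokhod convergence on `[0,t]` implies `L¹` convergence (embedding `D ↪ L¹_loc`).**
Fix `t > 0`. Let `f : [0,t] → ℝ` be càdlàg (right-continuous on `[0,t)` with left limits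
on `(0,t]`), let `fn` be Borel measurable functions, and let `τ n` be continuous, strictly
increasing bijections of `[0,t]` onto itself such that `sup_{s∈[0,t]} |τ n s − s| → 0` and
`sup_{s∈[0,t]} |f (τ n s) − fn n s| → 0`. Then `∫₀ᵗ |fn n s − f s| ds → 0`. -/
theorem skorokhod_implies_L1
    (t : ℝ) (ht : 0 < t)
    (f : ℝ → ℝ) (fn : ℕ → ℝ → ℝ) (τ : ℕ → ℝ → ℝ)
    (hf_right : ∀ s ∈ Set.Ico (0:ℝ) t, ContinuousWithinAt f (Set.Ici s) s)
    (hf_left : ∀ s ∈ Set.Ioc (0:ℝ) t,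
      ∃ l : ℝ, Filter.Tendsto f (nhdsWithin s (Set.Iio s)) (nhds l))
    (hfn_meas : ∀ n, Measurable (fn n))
    (hτ_cont : ∀ n, ContinuousOn (τ n) (Set.Icc 0 t))
    (hτ_mono : ∀ n, StrictMonoOn (τ n) (Set.Icc 0 t))
    (hτ_bij : ∀ n, Set.BijOn (τ n) (Set.Icc 0 t) (Set.Icc 0 t))
    (hτ_id : ∀ ε : ℝ, 0 < ε → ∃ N : ℕ, ∀ n ≥ N, ∀ s ∈ Set.Icc (0:ℝ) t,
      |τ n s - s| ≤ ε)
    (hfτ : ∀ ε : ℝ, 0 < ε → ∃ N : ℕ, ∀ n ≥ N, ∀ s ∈ Set.Icc (0:ℝ) t,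
      |f (τ n s) - fn n s| ≤ ε) :
    Filter.Tendsto (fun n => ∫ s in (0:ℝ)..t, |fn n s - f s|)
      Filter.atTop (nhds 0) := by
  obtain ⟨M, hM⟩ := bdd_aux t f hf_right hf_left
  have hC := countable_aux t f hf_right
  have hg : Measurable ((Set.Ioo 0 t).indicator f) := by
    apply measurable_of_countable_not_continuousAt
    refine (hC.union (Set.toFinite {0, t}).countable).mono ?_
    intro x hx
    by_contra hcon
    simp only [Set.mem_union, Set.mem_ofPred_eq, Set.mem_insert_iff, Set.mem_singleton_iff,
      not_or, not_and, not_not] at hcon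
    apply hx
    by_cases hx1 : x ∈ Set.Ioo 0 t
    · refine (hcon.1 hx1).congr ?_
      filter_upwards [Ioo_mem_nhds hx1.1 hx1.2] with y hy
      exact (Set.indicator_of_mem hy f).symm
    · have : x ∈ (Set.Icc 0 t)ᶜ := by
        intro h
        exact hx1 ⟨lt_of_le_of_ne h.1 (Ne.symm hcon.2.1), lt_of_le_of_ne h.2 hcon.2.2⟩
      refine (continuousAt_const (y := (0:ℝ))).congr ?_
      filter_upwards [isClosed_Icc.isOpen_compl.mem_nhds this] with y hy
      exact (Set.indicator_of_notMem (fun h => hy (Set.Ioo_subset_Icc_self h)) f).symm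
  have hne : ∀ᵐ x : ℝ, x ≠ t := by simp [ae_iff]
  have hfm : AEStronglyMeasurable f (volume.restrict (Set.uIoc 0 t)) := by
    refine hg.aestronglyMeasurable.congr ?_
    rw [Set.uIoc_of_le ht.le]
    filter_upwards [ae_restrict_mem measurableSet_Ioc, ae_restrict_of_ae hne] with x hx hxt
    have hx2 : x ∈ Set.Ioo 0 t := ⟨hx.1, lt_of_le_of_ne hx.2 hxt⟩
    exact Set.indicator_of_mem hx2 f
  have hz : (0:ℝ) = ∫ s in (0:ℝ)..t, (0:ℝ) := by simp
  suffices h : Tendsto (fun n => ∫ s in (0:ℝ)..t, |fn n s - f s|) atTop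
      (nhds (∫ s in (0:ℝ)..t, (0:ℝ))) by rwa [← hz] at h
  refine intervalIntegral.tendsto_integral_filter_of_dominated_convergence
    (fun _ => 1 + M + M) ?_ ?_ ?_ ?_
  · exact Eventually.of_forall fun n => ((hfn_meas n).aestronglyMeasurable.sub hfm).norm
  · obtain ⟨N, hN⟩ := hfτ 1 one_pos
    filter_upwards [eventually_ge_atTop N] with n hn
    refine Eventually.of_forall fun x hx => ?_
    rw [Set.uIoc_of_le ht.le] at hx
    have hx' : x ∈ Set.Icc 0 t := Set.Ioc_subset_Icc_self hx
    have h1 := abs_le.1 (hN n hn x hx')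
    have h2 := abs_le.1 (hM x hx')
    have h3 := abs_le.1 (hM _ ((hτ_bij n).mapsTo hx'))
    rw [Real.norm_eq_abs, abs_abs, abs_le]
    constructor <;> linarith [h1.1, h1.2, h2.1, h2.2, h3.1, h3.2]
  · exact intervalIntegrable_const
  · filter_upwards [hne, hC.ae_notMem volume] with x hxt hxc hx
    rw [Set.uIoc_of_le ht.le] at hx
    have hx' : x ∈ Set.Icc 0 t := Set.Ioc_subset_Icc_self hx
    have hc : ContinuousAt f x := by
      by_contra h
      exact hxc ⟨⟨hx.1, lt_of_le_of_ne hx.2 hxt⟩, h⟩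
    have hτ : Tendsto (fun n => τ n x) atTop (nhds x) := by
      rw [Metric.tendsto_atTop]
      intro ε hε
      obtain ⟨N, hN⟩ := hτ_id (ε / 2) (half_pos hε)
      exact ⟨N, fun n hn => by
        rw [Real.dist_eq]; exact (hN n hn x hx').trans_lt (half_lt_self hε)⟩
    have h1 : Tendsto (fun n => f (τ n x)) atTop (nhds (f x)) := hc.tendsto.comp hτ
    have h2 : Tendsto (fun n => f (τ n x) - fn n x) atTop (nhds 0) := by
      rw [Metric.tendsto_atTop]
      intro ε hε
      obtain ⟨N, hN⟩ := hfτ (ε / 2) (half_pos hε)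
      exact ⟨N, fun n hn => by
        rw [Real.dist_eq, sub_zero]; exact (hN n hn x hx').trans_lt (half_lt_self hε)⟩
    have h3 := ((h1.sub h2).sub_const (f x)).abs
    simpa using h3
end
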